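/- arXiv:2410.14375 — 7 statements merged into one kernel-verified Lean document; each statement's English description precedes it below -/
import Mathlib

section
/- In a bivariate confounded SCM, fix x ∈ X such that P(X = x, U = u) > 0 for every u in the support of μ. Then the interventional distribution equals the backdoor-adjusted observational quantity: P(Y = y | do(X = x)) = Σ_u P(Y = y | X = x, U = u) · μ(u) for every y, where the conditional on the right-hand side is computed from the observational joint distribution. In particular, the default-regime predictor obtained by replacing the conditional p(u | x) with the marginal p(u), namely Σ_u p(y | x, u) p(u), recovers p(y | do(x)). -/
open Finset

/-- `p` is a probability mass function on a finite type. -/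
def IsPMF {α : Type*} [Fintype α] (p : α → ℝ) : Prop :=
  (∀ a, 0 ≤ p a) ∧ ∑ a, p a = 1

section BivariateSCM

variable {U N M X Y : Type*}
  [Fintype U] [Fintype N] [Fintype M] [Fintype X] [Fintype Y]
  [DecidableEq X] [DecidableEq Y]

/-- The observational joint probability `P(U = u, X = x, Y = y)`: the pushforward of
`μ × ν × ρ` under `X := fX(U, N)`, `Y := fY(U, X, M)`. -/
def pUXY (μ : U → ℝ) (ν : N → ℝ) (ρ : M → ℝ)
    (fX : U → N → X) (fY : U → X → M → Y) (u : U) (x : X) (y : Y) : ℝ :=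
  ∑ n, ∑ m, if fX u n = x ∧ fY u x m = y then μ u * ν n * ρ m else 0

/-- The marginal probability `P(U = u, X = x)`. -/
def pUX (μ : U → ℝ) (ν : N → ℝ) (ρ : M → ℝ)
    (fX : U → N → X) (fY : U → X → M → Y) (u : U) (x : X) : ℝ :=
  ∑ y, pUXY μ ν ρ fX fY u x y

/-- The observational conditional `P(Y = y | X = x, U = u)`, a ratio of marginals. -/
noncomputable def condYXU (μ : U → ℝ) (ν : N → ℝ) (ρ : M → ℝ)
    (fX : U → N → X) (fY : U → X → M → Y) (y : Y) (x : X) (u : U) : ℝ :=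
  pUXY μ ν ρ fX fY u x y / pUX μ ν ρ fX fY u x

/-- The interventional distribution `P(Y = y | do(X = x))`. -/
def doP (μ : U → ℝ) (ρ : M → ℝ) (fY : U → X → M → Y) (x : X) (y : Y) : ℝ :=
  ∑ u, ∑ m, if fY u x m = y then μ u * ρ m else 0

omit [Fintype U] [Fintype X] [Fintype Y] in
/-- The joint law factors through the structural equations:
`P(U = u, X = x, Y = y) = μ(u) P(fX(u, N) = x) P(fY(u, x, M) = y)`. -/
theorem pUXY_eq_mul (μ : U → ℝ) (ν : N → ℝ) (ρ : M → ℝ)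
    (fX : U → N → X) (fY : U → X → M → Y) (u : U) (x : X) (y : Y) :
    pUXY μ ν ρ fX fY u x y =
      μ u * (∑ n, if fX u n = x then ν n else 0) * ∑ m, if fY u x m = y then ρ m else 0 := by
  rw [mul_assoc, sum_mul_sum, mul_sum]
  simp only [mul_sum]
  refine sum_congr rfl fun n _ => sum_congr rfl fun m _ => ?_
  by_cases hn : fX u n = x <;> by_cases hm : fY u x m = y <;> simp [hn, hm, mul_assoc]

omit [Fintype U] [Fintype X] in
/-- The marginal of `(U, X)` factors as `P(U = u, X = x) = μ(u) P(fX(u, N) = x)`. -/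
theorem pUX_eq_mul (μ : U → ℝ) (ν : N → ℝ) {ρ : M → ℝ} (hρ : ∑ m, ρ m = 1)
    (fX : U → N → X) (fY : U → X → M → Y) (u : U) (x : X) :
    pUX μ ν ρ fX fY u x = μ u * ∑ n, if fX u n = x then ν n else 0 := by
  simp only [pUX, pUXY_eq_mul, ← mul_sum]
  rw [sum_comm]
  simp [hρ]

omit [Fintype U] [Fintype X] in
/-- Where `P(U = u, X = x) ≠ 0`, the conditional `P(Y = y | X = x, U = u)` is the probability of
`fY(u, x, M) = y`. -/
theorem condYXU_eq_sum (μ : U → ℝ) (ν : N → ℝ) {ρ : M → ℝ} (hρ : ∑ m, ρ m = 1)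
    (fX : U → N → X) (fY : U → X → M → Y) (y : Y) {x : X} {u : U}
    (h : pUX μ ν ρ fX fY u x ≠ 0) :
    condYXU μ ν ρ fX fY y x u = ∑ m, if fY u x m = y then ρ m else 0 := by
  rw [condYXU, pUXY_eq_mul, ← pUX_eq_mul μ ν hρ fX fY, mul_div_cancel_left₀ _ h]

/-- Backdoor adjustment in a bivariate confounded SCM: if `P(X = x, U = u) > 0` for every
`u` in the support of `μ`, then `P(Y = y | do(X = x)) = Σ_u P(Y = y | X = x, U = u) · μ(u)`
for every `y`.  In particular, the default-regime predictor `Σ_u p(y | x, u) p(u)` recovers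
`p(y | do(x))`. -/
theorem statement2 (μ : U → ℝ) (ν : N → ℝ) (ρ : M → ℝ)
    (hμ : IsPMF μ) (hν : IsPMF ν) (hρ : IsPMF ρ)
    (fX : U → N → X) (fY : U → X → M → Y)
    (x : X) (hx : ∀ u, 0 < μ u → 0 < pUX μ ν ρ fX fY u x) :
    ∀ y, doP μ ρ fY x y = ∑ u, condYXU μ ν ρ fX fY y x u * μ u := by
  intro y
  refine sum_congr rfl fun u _ => ?_
  rcases (hμ.1 u).eq_or_lt with hu | hu
  · simp [← hu]
  · rw [condYXU_eq_sum μ ν hρ.2 fX fY y (hx u hu).ne', mul_comm, mul_sum]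
    simp only [mul_ite, mul_zero]

end BivariateSCM
end

section
/- There exist two bivariate confounded SCMs, with possibly different finite latent types and different exogenous distributions and structural functions but with the same observed types X and Y, such that the two models induce exactly the same observational joint distribution of (X, Y), yet their interventional distributions differ: P₁(Y = y | do(X = x)) ≠ P₂(Y = y | do(X = x)) for some x ∈ X and y ∈ Y. Hence p(y | do(x)) is not identifiable from the observational distribution of (X, Y) alone under a Markovian factorization p(u, x, y) = p(u) p(x | u) p(y | u, x) with latent U. -/
open Finset

/-- A bivariate confounded SCM with observed types `X` and `Y`: finite nonempty latent
(exogenous) types `U, N, M`, mutually independent exogenous distributions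
`U ~ μ`, `N ~ ν`, `M ~ ρ`, and structural functions `X := fX(U, N)`, `Y := fY(U, X, M)`. -/
structure BivSCM (X Y : Type) where
  U : Type
  N : Type
  M : Type
  [fintU : Fintype U]
  [fintN : Fintype N]
  [fintM : Fintype M]
  neU : Nonempty U
  neN : Nonempty N
  neM : Nonempty M
  μ : U → ℝ
  ν : N → ℝ
  ρ : M → ℝ
  hμ : IsPMF μ
  hν : IsPMF ν
  hρ : IsPMF ρ
  fX : U → N → X
  fY : U → X → M → Y

attribute [instance] BivSCM.fintU BivSCM.fintN BivSCM.fintM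

/-- The observational joint distribution of the observed pair `(X, Y)`:
`P(X = x, Y = y)`, the pushforward of `μ × ν × ρ` under the structural maps. -/
noncomputable def BivSCM.obsXY {X Y : Type} [DecidableEq X] [DecidableEq Y]
    (S : BivSCM X Y) (x : X) (y : Y) : ℝ :=
  ∑ u, ∑ n, ∑ m, if S.fX u n = x ∧ S.fY u x m = y then S.μ u * S.ν n * S.ρ m else 0

/-- The interventional distribution `P(Y = y | do(X = x))`. -/
noncomputable def BivSCM.doP {X Y : Type} [DecidableEq Y]
    (S : BivSCM X Y) (x : X) (y : Y) : ℝ :=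
  ∑ u, ∑ m, if S.fY u x m = y then S.μ u * S.ρ m else 0

/-- A fair coin `U` is copied into `X`, and `Y` is a function `f` of `U` and `X`. -/
noncomputable def coinSCM (f : Bool → Bool → Bool) : BivSCM Bool Bool where
  U := Bool
  N := Unit
  M := Unit
  neU := inferInstance
  neN := inferInstance
  neM := inferInstance
  μ _ := 1 / 2
  ν _ := 1
  ρ _ := 1
  hμ := ⟨fun _ => by norm_num, by norm_num⟩
  hν := ⟨fun _ => by norm_num, by simp⟩
  hρ := ⟨fun _ => by norm_num, by simp⟩
  fX u _ := u
  fY u x _ := f u x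

lemma obsXY_coinSCM (f : Bool → Bool → Bool) (x y : Bool) :
    (coinSCM f).obsXY x y = if f x x = y then 1 / 2 else 0 := by
  change ∑ u : Bool, ∑ _n : Unit, ∑ _m : Unit,
    (if u = x ∧ f u x = y then (1 / 2 : ℝ) * 1 * 1 else 0) = _
  cases x <;> simp

lemma doP_coinSCM (f : Bool → Bool → Bool) (x y : Bool) :
    (coinSCM f).doP x y = ∑ u : Bool, if f u x = y then 1 / 2 else 0 := by
  change ∑ u : Bool, ∑ _m : Unit, (if f u x = y then (1 / 2 : ℝ) * 1 else 0) = _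
  simp

/-- There exist two bivariate confounded SCMs (with possibly different finite latent types,
exogenous distributions and structural functions) over the same finite nonempty observed
types `X` and `Y`, inducing exactly the same observational joint distribution of `(X, Y)`,
yet with `P₁(Y = y | do(X = x)) ≠ P₂(Y = y | do(X = x))` for some `x, y`.  Hence
`p(y | do(x))` is not identifiable from the observational distribution of `(X, Y)` alone. -/
theorem statement4 :
    ∃ (X Y : Type) (_ : Fintype X) (_ : Fintype Y) (iX : DecidableEq X)
      (iY : DecidableEq Y) (_ : Nonempty X) (_ : Nonempty Y) (S₁ S₂ : BivSCM X Y),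
      (∀ x y, @BivSCM.obsXY X Y iX iY S₁ x y = @BivSCM.obsXY X Y iX iY S₂ x y) ∧
      ∃ x y, @BivSCM.doP X Y iY S₁ x y ≠ @BivSCM.doP X Y iY S₂ x y := by
  refine ⟨Bool, Bool, inferInstance, inferInstance, inferInstance, inferInstance, inferInstance,
    inferInstance, coinSCM fun u _ => u, coinSCM fun _ x => x, fun x y => ?_, true, true, ?_⟩
  · rw [obsXY_coinSCM, obsXY_coinSCM]
  · rw [doP_coinSCM, doP_coinSCM]
    norm_num
end

section
/- There exist a Fig-2 structural causal model and two probability mass functions μ1 and μ1* for the exogenous variable S1 (with all other exogenous distributions and all structural functions held fixed across the two regimes) such that for some triple (r0, r1, φ) receiving positive probability under both regimes, the conditional distribution of Y given (R0, R1, Φ) = (r0, r1, φ) differs between the regime using μ1 and the regime using μ1*. Hence conditioning on the full input representation (R0, R1, Φ) makes the prediction of Y depend on a regime variable σ that affects only the mechanism of S1. -/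
open Finset

/-- A Fig-2 structural causal model, with the distribution of the exogenous variable `S1`
left as a parameter (to be supplied per regime): finite nonempty exogenous types
`UΦ, US, S0, S1, NC, NY` with mutually independent exogenous distributions, finite
nonempty endogenous value types, and structural functions `Φ := fΦ(US, UΦ)`,
`C := fC(Φ, NC)`, `R0 := f0(S0, C)`, `R1 := f1(S1, C, US)`, `Y := fY(C, UΦ, NY)`. -/
structure Fig2SCM where
  UPhiT : Type
  UST : Type
  S0T : Type
  S1T : Type
  NCT : Type
  NYT : Type
  PhiT : Type
  CT : Type
  R0T : Type
  R1T : Type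
  YT : Type
  [finUPhi : Fintype UPhiT]
  [finUS : Fintype UST]
  [finS0 : Fintype S0T]
  [finS1 : Fintype S1T]
  [finNC : Fintype NCT]
  [finNY : Fintype NYT]
  [finPhi : Fintype PhiT]
  [finC : Fintype CT]
  [finR0 : Fintype R0T]
  [finR1 : Fintype R1T]
  [finY : Fintype YT]
  neUPhi : Nonempty UPhiT
  neUS : Nonempty UST
  neS0 : Nonempty S0T
  neS1 : Nonempty S1T
  neNC : Nonempty NCT
  neNY : Nonempty NYT
  nePhi : Nonempty PhiT
  neC : Nonempty CT
  neR0 : Nonempty R0T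
  neR1 : Nonempty R1T
  neY : Nonempty YT
  μPhi : UPhiT → ℝ
  μS : UST → ℝ
  μ0 : S0T → ℝ
  νC : NCT → ℝ
  νY : NYT → ℝ
  hμPhi : IsPMF μPhi
  hμS : IsPMF μS
  hμ0 : IsPMF μ0
  hνC : IsPMF νC
  hνY : IsPMF νY
  fPhi : UST → UPhiT → PhiT
  fC : PhiT → NCT → CT
  f0 : S0T → CT → R0T
  f1 : S1T → CT → UST → R1T
  fY : CT → UPhiT → NYT → YT

attribute [instance] Fig2SCM.finUPhi Fig2SCM.finUS Fig2SCM.finS0 Fig2SCM.finS1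
  Fig2SCM.finNC Fig2SCM.finNY Fig2SCM.finPhi Fig2SCM.finC Fig2SCM.finR0
  Fig2SCM.finR1 Fig2SCM.finY

open Classical in
/-- The observational marginal `P(R0 = r0, R1 = r1, Φ = φ)` of the model `M` run under
regime exogenous distribution `S1 ~ μ1` (pushforward of the product of the exogenous
distributions under the structural maps). -/
noncomputable def Fig2SCM.P3 (M : Fig2SCM) (μ1 : M.S1T → ℝ)
    (r0 : M.R0T) (r1 : M.R1T) (φ : M.PhiT) : ℝ :=
  ∑ uP, ∑ uS, ∑ s0, ∑ s1, ∑ nC, ∑ nY,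
    if M.f0 s0 (M.fC (M.fPhi uS uP) nC) = r0 ∧
        M.f1 s1 (M.fC (M.fPhi uS uP) nC) uS = r1 ∧ M.fPhi uS uP = φ then
      M.μPhi uP * M.μS uS * M.μ0 s0 * μ1 s1 * M.νC nC * M.νY nY
    else 0

open Classical in
/-- The observational joint `P(R0 = r0, R1 = r1, Φ = φ, Y = y)` under `S1 ~ μ1`. -/
noncomputable def Fig2SCM.P4 (M : Fig2SCM) (μ1 : M.S1T → ℝ)
    (r0 : M.R0T) (r1 : M.R1T) (φ : M.PhiT) (y : M.YT) : ℝ :=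
  ∑ uP, ∑ uS, ∑ s0, ∑ s1, ∑ nC, ∑ nY,
    if M.f0 s0 (M.fC (M.fPhi uS uP) nC) = r0 ∧
        M.f1 s1 (M.fC (M.fPhi uS uP) nC) uS = r1 ∧ M.fPhi uS uP = φ ∧
        M.fY (M.fC (M.fPhi uS uP) nC) uP nY = y then
      M.μPhi uP * M.μS uS * M.μ0 s0 * μ1 s1 * M.νC nC * M.νY nY
    else 0

/-- The observational conditional `P(Y = y | R0 = r0, R1 = r1, Φ = φ)` under `S1 ~ μ1`,
a ratio of marginals. -/
noncomputable def Fig2SCM.condY (M : Fig2SCM) (μ1 : M.S1T → ℝ)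
    (r0 : M.R0T) (r1 : M.R1T) (φ : M.PhiT) (y : M.YT) : ℝ :=
  M.P4 μ1 r0 r1 φ y / M.P3 μ1 r0 r1 φ

theorem isPMF_half : IsPMF (fun _ : Bool => (1 / 2 : ℝ)) :=
  ⟨fun _ => by norm_num, by norm_num⟩

theorem isPMF_unit : IsPMF (fun _ : Unit => (1 : ℝ)) :=
  ⟨fun _ => zero_le_one, by simp⟩

/-- The model with fair coins `UΦ`, `US`, a binary `S1`, and `Φ := US xor UΦ`,
`R1 := S1 xor US`, `Y := UΦ`; all other variables are trivial. -/
noncomputable def xorSCM : Fig2SCM where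
  UPhiT := Bool
  UST := Bool
  S0T := Unit
  S1T := Bool
  NCT := Unit
  NYT := Unit
  PhiT := Bool
  CT := Unit
  R0T := Unit
  R1T := Bool
  YT := Bool
  neUPhi := inferInstance
  neUS := inferInstance
  neS0 := inferInstance
  neS1 := inferInstance
  neNC := inferInstance
  neNY := inferInstance
  nePhi := inferInstance
  neC := inferInstance
  neR0 := inferInstance
  neR1 := inferInstance
  neY := inferInstance
  μPhi := fun _ => 1 / 2
  μS := fun _ => 1 / 2
  μ0 := fun _ => 1
  νC := fun _ => 1
  νY := fun _ => 1
  hμPhi := isPMF_half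
  hμS := isPMF_half
  hμ0 := isPMF_unit
  hνC := isPMF_unit
  hνY := isPMF_unit
  fPhi := fun uS uP => xor uS uP
  fC := fun _ _ => ()
  f0 := fun _ _ => ()
  f1 := fun s1 _ uS => xor s1 uS
  fY := fun _ uP _ => uP

theorem xorSCM_P3 (μ : Bool → ℝ) :
    xorSCM.P3 μ () false false = (μ true + μ false) / 4 := by
  have h : xorSCM.P3 μ () false false =
      ∑ uP : Bool, ∑ uS : Bool, ∑ _s0 : Unit, ∑ s1 : Bool, ∑ _nC : Unit, ∑ _nY : Unit,
        if () = () ∧ xor s1 uS = false ∧ xor uS uP = false then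
          (1 / 2 : ℝ) * (1 / 2) * 1 * μ s1 * 1 * 1
        else 0 := by
    iterate 6 refine Finset.sum_congr rfl fun _ _ => ?_
    exact @if_congr _ _ _ (_) (_) _ _ _ _ Iff.rfl rfl rfl
  rw [h]
  simp
  ring

theorem xorSCM_P4 (μ : Bool → ℝ) :
    xorSCM.P4 μ () false false true = μ true / 4 := by
  have h : xorSCM.P4 μ () false false true =
      ∑ uP : Bool, ∑ uS : Bool, ∑ _s0 : Unit, ∑ s1 : Bool, ∑ _nC : Unit, ∑ _nY : Unit,
        if () = () ∧ xor s1 uS = false ∧ xor uS uP = false ∧ uP = true then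
          (1 / 2 : ℝ) * (1 / 2) * 1 * μ s1 * 1 * 1
        else 0 := by
    iterate 6 refine Finset.sum_congr rfl fun _ _ => ?_
    exact @if_congr _ _ _ (_) (_) _ _ _ _ Iff.rfl rfl rfl
  rw [h]
  simp
  ring

/-- For any distribution of `S1`, the conditional probability of `Y = true` is the
probability of `S1 = true`. -/
theorem xorSCM_condY {μ : Bool → ℝ} (hμ : IsPMF μ) :
    xorSCM.condY μ () false false true = μ true := by
  have h : μ true + μ false = 1 := by simpa using hμ.2
  unfold Fig2SCM.condY
  rw [xorSCM_P3, xorSCM_P4, h]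
  ring

theorem xorSCM_P3_pos {μ : Bool → ℝ} (hμ : IsPMF μ) :
    0 < xorSCM.P3 μ () false false := by
  have h : μ true + μ false = 1 := by simpa using hμ.2
  rw [xorSCM_P3, h]
  norm_num

/-- There exist a Fig-2 structural causal model and two pmfs `μ1`, `μ1star` for the
exogenous variable `S1` (all other exogenous distributions and structural functions held
fixed) such that for some triple `(r0, r1, φ)` of positive probability under both regimes,
the conditional distribution of `Y` given `(R0, R1, Φ) = (r0, r1, φ)` differs between the
two regimes.  Hence conditioning on the full input representation `(R0, R1, Φ)` makes the
prediction of `Y` depend on a regime variable affecting only the mechanism of `S1`. -/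
theorem statement6 :
    ∃ (M : Fig2SCM) (μ1 μ1star : M.S1T → ℝ),
      IsPMF μ1 ∧ IsPMF μ1star ∧
      ∃ (r0 : M.R0T) (r1 : M.R1T) (φ : M.PhiT),
        0 < M.P3 μ1 r0 r1 φ ∧ 0 < M.P3 μ1star r0 r1 φ ∧
        ∃ y : M.YT, M.condY μ1 r0 r1 φ y ≠ M.condY μ1star r0 r1 φ y := by
  have hstar : IsPMF (fun b : Bool => if b then (1 / 4 : ℝ) else 3 / 4) :=
    ⟨fun b => by cases b <;> norm_num, by norm_num⟩
  refine ⟨xorSCM, _, _, isPMF_half, hstar, (), false, false,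
    xorSCM_P3_pos isPMF_half, xorSCM_P3_pos hstar, true, ?_⟩
  rw [xorSCM_condY isPMF_half, xorSCM_condY hstar]
  norm_num
end

section
/- In a Fig-2 structural causal model, fix φ' and c with P(Φ = φ', C = c) > 0. Then: (i) UΦ and C are conditionally independent given Φ, i.e. P(UΦ = uΦ | Φ = φ', C = c) = P(UΦ = uΦ | Φ = φ') for every uΦ; and (ii) the conditional distribution of Y given (Φ, C) is the mixture of the mechanism for Y over the posterior of UΦ given Φ alone: P(Y = y | Φ = φ', C = c) = Σ_{uΦ} P(UΦ = uΦ | Φ = φ') · Σ_{nY} 1[fY(c, uΦ, nY) = y] νY(nY). -/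
open Finset

section Fig2

/- Exogenous types `UΦ, US, S0, S1, NC, NY` and endogenous value types
`Φ : PhiT`, `C : CT`, `R0 : R0T`, `R1 : R1T`, `Y : YT` of a Fig-2 structural causal
model, all finite and nonempty. -/
variable {UPhiT UST S0T S1T NCT NYT PhiT CT R0T R1T YT : Type*}
  [Fintype UPhiT] [Fintype UST] [Fintype S0T] [Fintype S1T] [Fintype NCT] [Fintype NYT]
  [Fintype PhiT] [Fintype CT] [Fintype R0T] [Fintype R1T] [Fintype YT]
  [Nonempty UPhiT] [Nonempty UST] [Nonempty S0T] [Nonempty S1T] [Nonempty NCT]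
  [Nonempty NYT] [Nonempty PhiT] [Nonempty CT] [Nonempty R0T] [Nonempty R1T] [Nonempty YT]

open Classical in
/-- Probability of an event on the exogenous variables, under the product of the
exogenous distributions `μΦ × μS × μ0 × μ1 × νC × νY`.  The observational probability of
any event on the endogenous variables is the probability of its preimage under the
structural maps, i.e. the pushforward measure. -/
noncomputable def Pev (μPhi : UPhiT → ℝ) (μS : UST → ℝ) (μ0 : S0T → ℝ) (μ1 : S1T → ℝ)
    (νC : NCT → ℝ) (νY : NYT → ℝ)
    (A : UPhiT → UST → S0T → S1T → NCT → NYT → Prop) : ℝ :=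
  ∑ uP, ∑ uS, ∑ s0, ∑ s1, ∑ nC, ∑ nY,
    if A uP uS s0 s1 nC nY then μPhi uP * μS uS * μ0 s0 * μ1 s1 * νC nC * νY nY else 0

variable (fPhi : UST → UPhiT → PhiT) (fC : PhiT → NCT → CT)
  (f0 : S0T → CT → R0T) (f1 : S1T → CT → UST → R1T) (fY : CT → UPhiT → NYT → YT)

/-- Value of the endogenous variable `Φ := fΦ(US, UΦ)`. -/
def PhiV (uS : UST) (uP : UPhiT) : PhiT := fPhi uS uP

/-- Value of the endogenous variable `C := fC(Φ, NC)`. -/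
def CV (uS : UST) (uP : UPhiT) (nC : NCT) : CT := fC (fPhi uS uP) nC

/-- Value of the endogenous variable `R0 := f0(S0, C)`. -/
def R0V (uS : UST) (uP : UPhiT) (nC : NCT) (s0 : S0T) : R0T := f0 s0 (fC (fPhi uS uP) nC)

/-- Value of the endogenous variable `R1 := f1(S1, C, US)`. -/
def R1V (uS : UST) (uP : UPhiT) (nC : NCT) (s1 : S1T) : R1T := f1 s1 (fC (fPhi uS uP) nC) uS

/-- Value of the endogenous variable `Y := fY(C, UΦ, NY)`. -/
def YV (uS : UST) (uP : UPhiT) (nC : NCT) (nY : NYT) : YT := fY (fC (fPhi uS uP) nC) uP nY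

open Classical in
/-- The interventional distribution `P(Y = y | do(C = c))`, obtained by substituting the
constant `c` for `C` in the structural equation for `Y`. -/
noncomputable def doPC (μPhi : UPhiT → ℝ) (νY : NYT → ℝ) (c : CT) (y : YT) : ℝ :=
  ∑ uP, ∑ nY, if fY c uP nY = y then μPhi uP * νY nY else 0


open Classical in
/-- The mechanism kernel `κ(y | c, uΦ) := Σ_{nY} 1[fY(c, uΦ, nY) = y] νY(nY)`. -/
noncomputable def kappa (νY : NYT → ℝ) (y : YT) (c : CT) (uP : UPhiT) : ℝ :=
  ∑ nY, if fY c uP nY = y then νY nY else 0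

variable (μPhi : UPhiT → ℝ) (μS : UST → ℝ) (μ0 : S0T → ℝ) (μ1 : S1T → ℝ)
  (νC : NCT → ℝ) (νY : NYT → ℝ)

/-- The observational marginal `P(Φ = φ)`. -/
noncomputable def PPhi (φ : PhiT) : ℝ :=
  Pev μPhi μS μ0 μ1 νC νY (fun uP uS _ _ _ _ => PhiV fPhi uS uP = φ)

/-- The observational marginal `P(Φ = φ, C = c)`. -/
noncomputable def PPhiC (φ : PhiT) (c : CT) : ℝ :=
  Pev μPhi μS μ0 μ1 νC νY (fun uP uS _ _ nC _ =>
    PhiV fPhi uS uP = φ ∧ CV fPhi fC uS uP nC = c)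

/-- The observational joint `P(UΦ = uP, Φ = φ)`. -/
noncomputable def PUPhiPhi (uP : UPhiT) (φ : PhiT) : ℝ :=
  Pev μPhi μS μ0 μ1 νC νY (fun uP' uS _ _ _ _ => uP' = uP ∧ PhiV fPhi uS uP' = φ)

/-- The observational joint `P(UΦ = uP, Φ = φ, C = c)`. -/
noncomputable def PUPhiPhiC (uP : UPhiT) (φ : PhiT) (c : CT) : ℝ :=
  Pev μPhi μS μ0 μ1 νC νY (fun uP' uS _ _ nC _ =>
    uP' = uP ∧ PhiV fPhi uS uP' = φ ∧ CV fPhi fC uS uP' nC = c)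

/-- The observational joint `P(Y = y, Φ = φ, C = c)`. -/
noncomputable def PYPhiC (y : YT) (φ : PhiT) (c : CT) : ℝ :=
  Pev μPhi μS μ0 μ1 νC νY (fun uP uS _ _ nC nY =>
    PhiV fPhi uS uP = φ ∧ CV fPhi fC uS uP nC = c ∧ YV fPhi fC fY uS uP nC nY = y)

open Classical in
/-- Under the product distribution, an event that is a conjunction of conditions on
`(UΦ, US)`, on `NC` and on `(UΦ, NY)` has a probability that factorizes given `UΦ`. -/
theorem Pev_and_and {UPhiT UST S0T S1T NCT NYT : Type*}
    [Fintype UPhiT] [Fintype UST] [Fintype S0T] [Fintype S1T] [Fintype NCT] [Fintype NYT]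
    (μPhi : UPhiT → ℝ) (μS : UST → ℝ) {μ0 : S0T → ℝ} {μ1 : S1T → ℝ}
    (νC : NCT → ℝ) (νY : NYT → ℝ) (h0 : ∑ s, μ0 s = 1) (h1 : ∑ s, μ1 s = 1)
    {A : UPhiT → UST → S0T → S1T → NCT → NYT → Prop}
    (P : UPhiT → UST → Prop) (Q : NCT → Prop) (R : UPhiT → NYT → Prop)
    (hA : ∀ uP uS s0 s1 nC nY, A uP uS s0 s1 nC nY ↔ P uP uS ∧ Q nC ∧ R uP nY) :
    Pev μPhi μS μ0 μ1 νC νY A =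
      ∑ uP, (∑ uS, if P uP uS then μPhi uP * μS uS else 0) *
        (∑ nC, if Q nC then νC nC else 0) * ∑ nY, if R uP nY then νY nY else 0 := by
  have key : ∀ uP uS s0 s1 nC nY,
      (if A uP uS s0 s1 nC nY then μPhi uP * μS uS * μ0 s0 * μ1 s1 * νC nC * νY nY else 0) =
        (if P uP uS then μPhi uP * μS uS else 0) * (μ0 s0 * (μ1 s1 *
          ((if Q nC then νC nC else 0) * (if R uP nY then νY nY else 0)))) := by
    intro uP uS s0 s1 nC nY
    by_cases hP : P uP uS <;> by_cases hQ : Q nC <;> by_cases hR : R uP nY <;>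
      simp [hA, hP, hQ, hR, mul_assoc]
  simp only [Pev, key]
  simp only [← Finset.mul_sum, ← Finset.sum_mul, h0, h1, one_mul, mul_assoc]

/-- In a Fig-2 structural causal model, fix `φ'` and `c` with `P(Φ = φ', C = c) > 0`.
Then: (i) `UΦ ⫫ C | Φ`, i.e. `P(UΦ = uΦ | Φ = φ', C = c) = P(UΦ = uΦ | Φ = φ')` for every
`uΦ`; and (ii) `P(Y = y | Φ = φ', C = c)
= Σ_{uΦ} P(UΦ = uΦ | Φ = φ') · Σ_{nY} 1[fY(c, uΦ, nY) = y] νY(nY)`. -/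
theorem statement8
    (hμPhi : IsPMF μPhi) (hμS : IsPMF μS) (hμ0 : IsPMF μ0) (hμ1 : IsPMF μ1)
    (hνC : IsPMF νC) (hνY : IsPMF νY)
    (φ' : PhiT) (c : CT) (hpos : 0 < PPhiC fPhi fC μPhi μS μ0 μ1 νC νY φ' c) :
    (∀ uP : UPhiT,
      PUPhiPhiC fPhi fC μPhi μS μ0 μ1 νC νY uP φ' c /
          PPhiC fPhi fC μPhi μS μ0 μ1 νC νY φ' c =
        PUPhiPhi fPhi μPhi μS μ0 μ1 νC νY uP φ' / PPhi fPhi μPhi μS μ0 μ1 νC νY φ') ∧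
    (∀ y : YT,
      PYPhiC fPhi fC fY μPhi μS μ0 μ1 νC νY y φ' c /
          PPhiC fPhi fC μPhi μS μ0 μ1 νC νY φ' c =
        ∑ uP, (PUPhiPhi fPhi μPhi μS μ0 μ1 νC νY uP φ' /
            PPhi fPhi μPhi μS μ0 μ1 νC νY φ') * kappa fY νY y c uP) := by
  classical
  set w : UPhiT → ℝ := fun uP => ∑ uS, if fPhi uS uP = φ' then μPhi uP * μS uS else 0 with hw
  set q : ℝ := ∑ nC, if fC φ' nC = c then νC nC else 0 with hq
  have hΦC : PPhiC fPhi fC μPhi μS μ0 μ1 νC νY φ' c = (∑ uP, w uP) * q := by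
    rw [PPhiC, Pev_and_and μPhi μS νC νY hμ0.2 hμ1.2 (fun uP uS => fPhi uS uP = φ')
      (fun nC => fC φ' nC = c) (fun _ _ => True) (by simp +contextual [PhiV, CV])]
    simp [hw, hq, hνY.2, Finset.sum_mul]
  have hΦ : PPhi fPhi μPhi μS μ0 μ1 νC νY φ' = ∑ uP, w uP := by
    rw [PPhi, Pev_and_and μPhi μS νC νY hμ0.2 hμ1.2 (fun uP uS => fPhi uS uP = φ')
      (fun _ => True) (fun _ _ => True) (by simp [PhiV])]
    simp [hw, hνC.2, hνY.2]
  have hUΦC (uP : UPhiT) : PUPhiPhiC fPhi fC μPhi μS μ0 μ1 νC νY uP φ' c = w uP * q := by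
    rw [PUPhiPhiC, Pev_and_and μPhi μS νC νY hμ0.2 hμ1.2
      (fun uP' uS => uP' = uP ∧ fPhi uS uP' = φ')
      (fun nC => fC φ' nC = c) (fun _ _ => True) (by simp +contextual [PhiV, CV, and_assoc])]
    rw [Finset.sum_eq_single uP (by simp +contextual) (by simp)]
    simp [hw, hq, hνY.2]
  have hUΦ (uP : UPhiT) : PUPhiPhi fPhi μPhi μS μ0 μ1 νC νY uP φ' = w uP := by
    rw [PUPhiPhi, Pev_and_and μPhi μS νC νY hμ0.2 hμ1.2
      (fun uP' uS => uP' = uP ∧ fPhi uS uP' = φ')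
      (fun _ => True) (fun _ _ => True) (by simp [PhiV])]
    rw [Finset.sum_eq_single uP (by simp +contextual) (by simp)]
    simp [hw, hνC.2, hνY.2]
  have hYΦC (y : YT) : PYPhiC fPhi fC fY μPhi μS μ0 μ1 νC νY y φ' c =
      ∑ uP, w uP * q * kappa fY νY y c uP := by
    rw [PYPhiC, Pev_and_and μPhi μS νC νY hμ0.2 hμ1.2 (fun uP uS => fPhi uS uP = φ')
      (fun nC => fC φ' nC = c) (fun uP nY => fY c uP nY = y)
      (by simp +contextual [PhiV, CV, YV])]
    simp only [hw, hq, kappa]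
  rw [hΦC] at hpos ⊢
  have hq0 : q ≠ 0 := right_ne_zero_of_mul hpos.ne'
  have hcancel (uP : UPhiT) : w uP * q / ((∑ uP, w uP) * q) = w uP / ∑ uP, w uP :=
    mul_div_mul_right _ _ hq0
  refine ⟨fun uP => ?_, fun y => ?_⟩
  · rw [hUΦC, hUΦ, hΦ, hcancel]
  · simp only [hYΦC, hUΦ, hΦ, Finset.sum_div, mul_div_right_comm _ (kappa _ _ _ _ _), hcancel]


end Fig2
end

section
/- In a Fig-2 structural causal model, fix c such that P(Φ = φ', C = c) > 0 for every φ' with P(Φ = φ') > 0. Then the interventional distribution of Y under do(C = c) satisfies the backdoor adjustment formula over Φ: P(Y = y | do(C = c)) = Σ_{φ'} P(Y = y | Φ = φ', C = c) · P(Φ = φ') for every y, where the sum ranges over φ' with P(Φ = φ') > 0 and all conditionals on the right-hand side are computed from the observational joint distribution. -/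
open Finset

section Fig2

/- Exogenous types `UΦ, US, S0, S1, NC, NY` and endogenous value types
`Φ : PhiT`, `C : CT`, `R0 : R0T`, `R1 : R1T`, `Y : YT` of a Fig-2 structural causal
model, all finite and nonempty. -/
variable {UPhiT UST S0T S1T NCT NYT PhiT CT R0T R1T YT : Type*}
  [Fintype UPhiT] [Fintype UST] [Fintype S0T] [Fintype S1T] [Fintype NCT] [Fintype NYT]
  [Fintype PhiT] [Fintype CT] [Fintype R0T] [Fintype R1T] [Fintype YT]
  [Nonempty UPhiT] [Nonempty UST] [Nonempty S0T] [Nonempty S1T] [Nonempty NCT]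
  [Nonempty NYT] [Nonempty PhiT] [Nonempty CT] [Nonempty R0T] [Nonempty R1T] [Nonempty YT]

variable (fPhi : UST → UPhiT → PhiT) (fC : PhiT → NCT → CT)
  (f0 : S0T → CT → R0T) (f1 : S1T → CT → UST → R1T) (fY : CT → UPhiT → NYT → YT)

variable (μPhi : UPhiT → ℝ) (μS : UST → ℝ) (μ0 : S0T → ℝ) (μ1 : S1T → ℝ)
  (νC : NCT → ℝ) (νY : NYT → ℝ)

/-- The observational conditional `P(Y = y | Φ = φ, C = c)`, a ratio of marginals. -/
noncomputable def condYPhiC (y : YT) (φ : PhiT) (c : CT) : ℝ :=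
  PYPhiC fPhi fC fY μPhi μS μ0 μ1 νC νY y φ c / PPhiC fPhi fC μPhi μS μ0 μ1 νC νY φ c

omit [Nonempty UPhiT] [Nonempty UST] [Nonempty S0T] [Nonempty S1T] [Nonempty NCT]
  [Nonempty NYT] in
/-- An event that splits into a part on `(UΦ, US, NY)` and a part on `NC` has product
probability. -/
lemma Pev_and_eq_mul {μPhi : UPhiT → ℝ} {μS : UST → ℝ} {μ0 : S0T → ℝ} {μ1 : S1T → ℝ}
    {νC : NCT → ℝ} {νY : NYT → ℝ} (hμ0 : IsPMF μ0) (hμ1 : IsPMF μ1)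
    (B : UPhiT → UST → NYT → Prop) (D : NCT → Prop)
    [∀ uP uS nY, Decidable (B uP uS nY)] [DecidablePred D] :
    Pev μPhi μS μ0 μ1 νC νY (fun uP uS _ _ nC nY => B uP uS nY ∧ D nC) =
      (∑ uP, ∑ uS, ∑ nY, if B uP uS nY then μPhi uP * μS uS * νY nY else 0) *
        ∑ nC, if D nC then νC nC else 0 := by
  have split : ∀ uP uS s0 s1,
      (∑ nC, ∑ nY, @ite ℝ (B uP uS nY ∧ D nC) (Classical.propDecidable _)
        (μPhi uP * μS uS * μ0 s0 * μ1 s1 * νC nC * νY nY) 0) =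
      μ0 s0 * (μ1 s1 * ((∑ nY, if B uP uS nY then μPhi uP * μS uS * νY nY else 0) *
        ∑ nC, if D nC then νC nC else 0)) := by
    intro uP uS s0 s1
    rw [Finset.sum_mul_sum, Finset.sum_comm]
    simp only [Finset.mul_sum]
    refine Finset.sum_congr rfl fun nY _ => Finset.sum_congr rfl fun nC _ => ?_
    by_cases hB : B uP uS nY <;> by_cases hD : D nC <;> simp [hB, hD]
    ring
  unfold Pev
  simp only [split, ← Finset.mul_sum, ← Finset.sum_mul, hμ0.2, hμ1.2, one_mul]

omit [Nonempty UPhiT] [Nonempty UST] [Nonempty S0T] [Nonempty S1T] [Nonempty NCT]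
  [Nonempty NYT] in
/-- The probability of an event on `(UΦ, US, NY)`. -/
lemma Pev_eq_sum {μPhi : UPhiT → ℝ} {μS : UST → ℝ} {μ0 : S0T → ℝ} {μ1 : S1T → ℝ}
    {νC : NCT → ℝ} {νY : NYT → ℝ} (hμ0 : IsPMF μ0) (hμ1 : IsPMF μ1) (hνC : IsPMF νC)
    (B : UPhiT → UST → NYT → Prop) [∀ uP uS nY, Decidable (B uP uS nY)] :
    Pev μPhi μS μ0 μ1 νC νY (fun uP uS _ _ _ nY => B uP uS nY) =
      ∑ uP, ∑ uS, ∑ nY, if B uP uS nY then μPhi uP * μS uS * νY nY else 0 := by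
  simpa [hνC.2] using
    Pev_and_eq_mul (μPhi := μPhi) (μS := μS) (νC := νC) (νY := νY) hμ0 hμ1 B fun _ => True

omit [Fintype CT] [Fintype YT] [Nonempty UPhiT] [Nonempty UST] [Nonempty NYT]
  [Nonempty PhiT] [Nonempty CT] [Nonempty YT] in
open Classical in
/-- The interventional distribution disintegrates over the values of `Φ`. -/
lemma doPC_eq_sum_fiber (fPhi : UST → UPhiT → PhiT) (fY : CT → UPhiT → NYT → YT)
    {μPhi : UPhiT → ℝ} {μS : UST → ℝ} {νY : NYT → ℝ} (hμS : IsPMF μS) (c : CT) (y : YT) :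
    doPC fY μPhi νY c y = ∑ φ : PhiT, ∑ uP, ∑ uS, ∑ nY,
      if fPhi uS uP = φ ∧ fY c uP nY = y then μPhi uP * μS uS * νY nY else 0 := by
  unfold doPC
  conv_rhs => rw [Finset.sum_comm]
  refine Finset.sum_congr rfl fun uP _ => ?_
  conv_rhs => rw [Finset.sum_comm]
  have fiber : ∀ uS, (∑ φ : PhiT, ∑ nY,
      if fPhi uS uP = φ ∧ fY c uP nY = y then μPhi uP * μS uS * νY nY else 0) =
      μS uS * ∑ nY, if fY c uP nY = y then μPhi uP * νY nY else 0 := by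
    intro uS
    rw [Finset.sum_comm, Finset.mul_sum]
    refine Finset.sum_congr rfl fun nY _ => ?_
    by_cases hY : fY c uP nY = y
    · simp only [hY, and_true, if_true, Finset.sum_ite_eq, Finset.mem_univ]
      ring
    · simp [hY]
  simp only [fiber, ← Finset.sum_mul, hμS.2, one_mul]

open Classical in
/-- Backdoor adjustment over `Φ` in a Fig-2 structural causal model: if `c` is such that
`P(Φ = φ', C = c) > 0` for every `φ'` with `P(Φ = φ') > 0`, then
`P(Y = y | do(C = c)) = Σ_{φ'} P(Y = y | Φ = φ', C = c) · P(Φ = φ')` for every `y`, the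
sum ranging over `φ'` with `P(Φ = φ') > 0`, all conditionals on the right-hand side being
observational. -/
theorem statement9
    (hμPhi : IsPMF μPhi) (hμS : IsPMF μS) (hμ0 : IsPMF μ0) (hμ1 : IsPMF μ1)
    (hνC : IsPMF νC) (hνY : IsPMF νY)
    (c : CT)
    (hc : ∀ φ' : PhiT, 0 < PPhi fPhi μPhi μS μ0 μ1 νC νY φ' →
      0 < PPhiC fPhi fC μPhi μS μ0 μ1 νC νY φ' c) :
    ∀ y : YT, doPC fY μPhi νY c y =
      ∑ φ' ∈ univ.filter (fun φ' => 0 < PPhi fPhi μPhi μS μ0 μ1 νC νY φ'),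
        condYPhiC fPhi fC fY μPhi μS μ0 μ1 νC νY y φ' c *
          PPhi fPhi μPhi μS μ0 μ1 νC νY φ' := by
  intro y
  let N : PhiT → ℝ := fun φ => ∑ uP, ∑ uS, ∑ nY,
    if fPhi uS uP = φ ∧ fY c uP nY = y then μPhi uP * μS uS * νY nY else 0
  let q : PhiT → ℝ := fun φ => ∑ nC, if fC φ nC = c then νC nC else 0
  have hP : ∀ φ, PPhi fPhi μPhi μS μ0 μ1 νC νY φ =
      ∑ uP, ∑ uS, ∑ nY, if fPhi uS uP = φ then μPhi uP * μS uS * νY nY else 0 := fun φ =>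
    Pev_eq_sum hμ0 hμ1 hνC fun uP uS _ => fPhi uS uP = φ
  have hPC : ∀ φ, PPhiC fPhi fC μPhi μS μ0 μ1 νC νY φ c =
      PPhi fPhi μPhi μS μ0 μ1 νC νY φ * q φ := by
    intro φ
    rw [hP]
    refine Eq.trans ?_ (Pev_and_eq_mul hμ0 hμ1 (fun uP uS _ => fPhi uS uP = φ)
      fun nC => fC φ nC = c)
    unfold PPhiC PhiV CV
    congr! 7
    exact and_congr_right fun h => by rw [h]
  have hPYC : ∀ φ, PYPhiC fPhi fC fY μPhi μS μ0 μ1 νC νY y φ c = N φ * q φ := by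
    intro φ
    refine Eq.trans ?_ (Pev_and_eq_mul hμ0 hμ1
      (fun uP uS nY => fPhi uS uP = φ ∧ fY c uP nY = y) fun nC => fC φ nC = c)
    unfold PYPhiC PhiV CV YV
    congr! 7
    constructor
    · rintro ⟨rfl, rfl, h⟩
      exact ⟨⟨rfl, h⟩, rfl⟩
    · rintro ⟨⟨rfl, h⟩, rfl⟩
      exact ⟨rfl, rfl, h⟩
  have weight_nonneg : ∀ uP uS nY, 0 ≤ μPhi uP * μS uS * νY nY := fun uP uS nY =>
    mul_nonneg (mul_nonneg (hμPhi.1 uP) (hμS.1 uS)) (hνY.1 nY)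
  have N_nonneg : ∀ φ, 0 ≤ N φ := fun φ =>
    Finset.sum_nonneg fun uP _ => Finset.sum_nonneg fun uS _ => Finset.sum_nonneg fun nY _ =>
      ite_nonneg (weight_nonneg uP uS nY) le_rfl
  have N_le : ∀ φ, N φ ≤ PPhi fPhi μPhi μS μ0 μ1 νC νY φ := by
    intro φ
    rw [hP]
    refine Finset.sum_le_sum fun uP _ => Finset.sum_le_sum fun uS _ =>
      Finset.sum_le_sum fun nY _ => ?_
    by_cases hφ : fPhi uS uP = φ <;> by_cases hY : fY c uP nY = y <;>
      simp [hφ, hY, weight_nonneg]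
  rw [doPC_eq_sum_fiber fPhi fY hμS c y]
  change ∑ φ, N φ = _
  rw [Finset.sum_filter]
  refine Finset.sum_congr rfl fun φ _ => ?_
  split_ifs with hpos
  · have hPCpos := hc φ hpos
    rw [hPC] at hPCpos
    have hq0 : q φ ≠ 0 := right_ne_zero_of_mul hPCpos.ne'
    rw [condYPhiC, hPYC, hPC]
    field_simp
  · exact le_antisymm ((N_le φ).trans (not_lt.mp hpos)) (N_nonneg φ)

end Fig2
end

section
/- In a Fig-2 structural causal model, define the observed input X := (R0, R1, Φ) and let πΦ denote the projection of a value of X onto its Φ-coordinate. Fix c such that P(Φ = φ', C = c) > 0 for every φ' with P(Φ = φ') > 0. Then the interventional distribution of Y under do(C = c) is identified from observational quantities by P(Y = y | do(C = c)) = Σ_{x'} P(Y = y | Φ = πΦ(x'), C = c) · P(X = x') for every y, where the sum ranges over values x' with P(X = x') > 0. This is the identification formula p(y | do(x)) = Σ_{Φ', x'} p(y | Φ', c) p(Φ' | x') p(x') for causal transfer learning, in which the intervention do(x) fixing the derived features (R0, R1, Φ) sets C to the value c determined by (r0, r1). -/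
open Finset

section Fig2

/- Exogenous types `UΦ, US, S0, S1, NC, NY` and endogenous value types
`Φ : PhiT`, `C : CT`, `R0 : R0T`, `R1 : R1T`, `Y : YT` of a Fig-2 structural causal
model, all finite and nonempty. -/
variable {UPhiT UST S0T S1T NCT NYT PhiT CT R0T R1T YT : Type*}
  [Fintype UPhiT] [Fintype UST] [Fintype S0T] [Fintype S1T] [Fintype NCT] [Fintype NYT]
  [Fintype PhiT] [Fintype CT] [Fintype R0T] [Fintype R1T] [Fintype YT]
  [Nonempty UPhiT] [Nonempty UST] [Nonempty S0T] [Nonempty S1T] [Nonempty NCT]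
  [Nonempty NYT] [Nonempty PhiT] [Nonempty CT] [Nonempty R0T] [Nonempty R1T] [Nonempty YT]

variable (fPhi : UST → UPhiT → PhiT) (fC : PhiT → NCT → CT)
  (f0 : S0T → CT → R0T) (f1 : S1T → CT → UST → R1T) (fY : CT → UPhiT → NYT → YT)

variable (μPhi : UPhiT → ℝ) (μS : UST → ℝ) (μ0 : S0T → ℝ) (μ1 : S1T → ℝ)
  (νC : NCT → ℝ) (νY : NYT → ℝ)

/-- The observational distribution `P(X = x')` of the observed input
`X := (R0, R1, Φ)`. -/
noncomputable def PX (x' : R0T × R1T × PhiT) : ℝ :=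
  Pev μPhi μS μ0 μ1 νC νY (fun uP uS s0 s1 nC _ =>
    R0V fPhi fC f0 uS uP nC s0 = x'.1 ∧ R1V fPhi fC f1 uS uP nC s1 = x'.2.1 ∧
      PhiV fPhi uS uP = x'.2.2)

section Probability

omit [Nonempty UPhiT] [Nonempty UST] [Nonempty S0T] [Nonempty S1T] [Nonempty NCT] [Nonempty NYT]

theorem Pev_nonneg {μPhi : UPhiT → ℝ} {μS : UST → ℝ} {μ0 : S0T → ℝ} {μ1 : S1T → ℝ}
    {νC : NCT → ℝ} {νY : NYT → ℝ}
    (hμPhi : IsPMF μPhi) (hμS : IsPMF μS) (hμ0 : IsPMF μ0) (hμ1 : IsPMF μ1)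
    (hνC : IsPMF νC) (hνY : IsPMF νY) (A : UPhiT → UST → S0T → S1T → NCT → NYT → Prop) :
    0 ≤ Pev μPhi μS μ0 μ1 νC νY A := by
  unfold Pev
  refine sum_nonneg fun uP _ => sum_nonneg fun uS _ => sum_nonneg fun s0 _ =>
    sum_nonneg fun s1 _ => sum_nonneg fun nC _ => sum_nonneg fun nY _ => ?_
  have := hμPhi.1 uP
  have := hμS.1 uS
  have := hμ0.1 s0
  have := hμ1.1 s1
  have := hνC.1 nC
  have := hνY.1 nY
  split_ifs <;> positivity

open Classical in
/-- Law of total probability over the values of a random variable `f`. -/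
theorem sum_Pev_and_eq {α : Type*} [Fintype α]
    (μPhi : UPhiT → ℝ) (μS : UST → ℝ) (μ0 : S0T → ℝ) (μ1 : S1T → ℝ)
    (νC : NCT → ℝ) (νY : NYT → ℝ) (A : UPhiT → UST → S0T → S1T → NCT → NYT → Prop)
    (f : UPhiT → UST → S0T → S1T → NCT → NYT → α) :
    ∑ a, Pev μPhi μS μ0 μ1 νC νY
      (fun uP uS s0 s1 nC nY => f uP uS s0 s1 nC nY = a ∧ A uP uS s0 s1 nC nY) =
      Pev μPhi μS μ0 μ1 νC νY A := by
  unfold Pev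
  rw [sum_comm]; refine sum_congr rfl fun uP _ => ?_
  rw [sum_comm]; refine sum_congr rfl fun uS _ => ?_
  rw [sum_comm]; refine sum_congr rfl fun s0 _ => ?_
  rw [sum_comm]; refine sum_congr rfl fun s1 _ => ?_
  rw [sum_comm]; refine sum_congr rfl fun nC _ => ?_
  rw [sum_comm]; refine sum_congr rfl fun nY _ => ?_
  by_cases hA : A uP uS s0 s1 nC nY <;> simp [hA]

open Classical in
/-- An event on `NC` is independent of an event on the other exogenous variables. -/
theorem Pev_and_NC (μPhi : UPhiT → ℝ) (μS : UST → ℝ) (μ0 : S0T → ℝ) (μ1 : S1T → ℝ)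
    {νC : NCT → ℝ} (νY : NYT → ℝ) (hνC : IsPMF νC)
    (B : UPhiT → UST → S0T → S1T → NYT → Prop) (D : NCT → Prop) :
    Pev μPhi μS μ0 μ1 νC νY (fun uP uS s0 s1 nC nY => B uP uS s0 s1 nY ∧ D nC) =
      Pev μPhi μS μ0 μ1 νC νY (fun uP uS s0 s1 _ nY => B uP uS s0 s1 nY) *
        ∑ nC, if D nC then νC nC else 0 := by
  unfold Pev
  simp_rw [sum_mul]
  refine sum_congr rfl fun uP _ => sum_congr rfl fun uS _ => sum_congr rfl fun s0 _ =>
    sum_congr rfl fun s1 _ => ?_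
  set g : NYT → ℝ := fun nY =>
    if B uP uS s0 s1 nY then μPhi uP * μS uS * μ0 s0 * μ1 s1 * νY nY else 0
  calc _ = (∑ nC, if D nC then νC nC else 0) * ∑ nY, g nY := by
        rw [sum_mul_sum]
        refine sum_congr rfl fun nC _ => sum_congr rfl fun nY _ => ?_
        by_cases hB : B uP uS s0 s1 nY <;> by_cases hD : D nC <;> simp [g, hB, hD]
        ring
    _ = ((∑ nC, νC nC) * ∑ nY, g nY) * ∑ nC, if D nC then νC nC else 0 := by
        rw [hνC.2]; ring
    _ = _ := by
        rw [sum_mul_sum, sum_mul]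
        refine sum_congr rfl fun nC _ => ?_
        rw [sum_mul]
        refine sum_congr rfl fun nY _ => ?_
        by_cases hB : B uP uS s0 s1 nY <;> simp [g, hB]
        left; ring

open Classical in
/-- The probability of an event on `(UΦ, NY)` only. -/
theorem Pev_UPhi_NY (μPhi : UPhiT → ℝ) {μS : UST → ℝ} {μ0 : S0T → ℝ} {μ1 : S1T → ℝ}
    {νC : NCT → ℝ} (νY : NYT → ℝ) (hμS : IsPMF μS) (hμ0 : IsPMF μ0) (hμ1 : IsPMF μ1)
    (hνC : IsPMF νC) (E : UPhiT → NYT → Prop) :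
    Pev μPhi μS μ0 μ1 νC νY (fun uP _ _ _ _ nY => E uP nY) =
      ∑ uP, ∑ nY, if E uP nY then μPhi uP * νY nY else 0 := by
  unfold Pev
  refine sum_congr rfl fun uP _ => ?_
  set g : NYT → ℝ := fun nY => if E uP nY then μPhi uP * νY nY else 0
  have key : ∀ uS s0 s1 nC nY,
      (if E uP nY then μPhi uP * μS uS * μ0 s0 * μ1 s1 * νC nC * νY nY else 0) =
        μS uS * (μ0 s0 * (μ1 s1 * (νC nC * g nY))) := by
    intro uS s0 s1 nC nY
    by_cases h : E uP nY <;> simp [g, h]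
    ring
  simp_rw [key, ← mul_sum, ← sum_mul, hμS.2, hμ0.2, hμ1.2, hνC.2, one_mul]

end Probability

open Classical in
/-- Identification formula for causal transfer learning in a Fig-2 structural causal
model with observed input `X := (R0, R1, Φ)` and `πΦ` the projection onto the
`Φ`-coordinate: if `P(Φ = φ', C = c) > 0` for every `φ'` with `P(Φ = φ') > 0`, then
`P(Y = y | do(C = c)) = Σ_{x'} P(Y = y | Φ = πΦ(x'), C = c) · P(X = x')` for every `y`,
the sum ranging over `x'` with `P(X = x') > 0`.  This is the formula
`p(y | do(x)) = Σ_{Φ', x'} p(y | Φ', c) p(Φ' | x') p(x')`, the intervention `do(x)` on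
the derived features `(R0, R1, Φ)` setting `C` to the value determined by `(r0, r1)`. -/
theorem statement10
    (hμPhi : IsPMF μPhi) (hμS : IsPMF μS) (hμ0 : IsPMF μ0) (hμ1 : IsPMF μ1)
    (hνC : IsPMF νC) (hνY : IsPMF νY)
    (c : CT)
    (hc : ∀ φ' : PhiT, 0 < PPhi fPhi μPhi μS μ0 μ1 νC νY φ' →
      0 < PPhiC fPhi fC μPhi μS μ0 μ1 νC νY φ' c) :
    ∀ y : YT, doPC fY μPhi νY c y =
      ∑ x' ∈ univ.filter (fun x' : R0T × R1T × PhiT =>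
          0 < PX fPhi fC f0 f1 μPhi μS μ0 μ1 νC νY x'),
        condYPhiC fPhi fC fY μPhi μS μ0 μ1 νC νY y x'.2.2 c *
          PX fPhi fC f0 f1 μPhi μS μ0 μ1 νC νY x' := by
  intro y
  set P := Pev μPhi μS μ0 μ1 νC νY with hP
  have hnn : ∀ A, 0 ≤ P A := Pev_nonneg hμPhi hμS hμ0 hμ1 hνC hνY
  set r : PhiT → ℝ := fun φ => P fun uP uS _ _ _ nY => fPhi uS uP = φ ∧ fY c uP nY = y with hr
  set q : PhiT → ℝ := fun φ => ∑ nC, if fC φ nC = c then νC nC else 0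
  have hdo : doPC fY μPhi νY c y = ∑ φ, r φ := by
    rw [hr, hP, sum_Pev_and_eq μPhi μS μ0 μ1 νC νY
      (fun uP _ _ _ _ nY => fY c uP nY = y) fun uP uS _ _ _ _ => fPhi uS uP,
      Pev_UPhi_NY μPhi νY hμS hμ0 hμ1 hνC]
    rfl
  have hPhiC : ∀ φ, PPhiC fPhi fC μPhi μS μ0 μ1 νC νY φ c =
      PPhi fPhi μPhi μS μ0 μ1 νC νY φ * q φ := by
    intro φ
    refine Eq.trans ?_ (Pev_and_NC μPhi μS μ0 μ1 νY hνC
      (fun uP uS _ _ _ => fPhi uS uP = φ) fun nC => fC φ nC = c)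
    unfold PPhiC PhiV CV
    congr! 7
    grind
  have hYPhiC : ∀ φ, PYPhiC fPhi fC fY μPhi μS μ0 μ1 νC νY y φ c = r φ * q φ := by
    intro φ
    refine Eq.trans ?_ (Pev_and_NC μPhi μS μ0 μ1 νY hνC
      (fun uP uS _ _ nY => fPhi uS uP = φ ∧ fY c uP nY = y) fun nC => fC φ nC = c)
    unfold PYPhiC PhiV CV YV
    congr! 7
    grind
  have hr_le : ∀ φ, r φ ≤ PPhi fPhi μPhi μS μ0 μ1 νC νY φ := by
    intro φ
    have h := sum_Pev_and_eq μPhi μS μ0 μ1 νC νY (fun uP uS _ _ _ _ => fPhi uS uP = φ)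
      fun uP _ _ _ _ nY => fY c uP nY
    refine le_trans ?_ h.le
    refine le_trans (le_of_eq ?_) (single_le_sum (fun a _ => hnn _) (mem_univ y))
    simp only [hr, and_comm]
  have hcond : ∀ φ, condYPhiC fPhi fC fY μPhi μS μ0 μ1 νC νY y φ c *
      PPhi fPhi μPhi μS μ0 μ1 νC νY φ = r φ := by
    intro φ
    rcases (hnn fun uP uS _ _ _ _ => PhiV fPhi uS uP = φ).eq_or_lt with h0 | hpos
    · have h0' : PPhi fPhi μPhi μS μ0 μ1 νC νY φ = 0 := h0.symm
      rw [h0', mul_zero]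
      exact le_antisymm (hnn _) (h0' ▸ hr_le φ)
    · have hpos' : 0 < PPhi fPhi μPhi μS μ0 μ1 νC νY φ := hpos
      have hC := hc φ hpos'
      rw [hPhiC] at hC
      have hq0 : q φ ≠ 0 := (pos_of_mul_pos_right hC hpos'.le).ne'
      have hp0 := hpos'.ne'
      rw [condYPhiC, hYPhiC, hPhiC]
      field_simp
  have hX : ∀ φ, ∑ a, ∑ b, PX fPhi fC f0 f1 μPhi μS μ0 μ1 νC νY (a, b, φ) =
      PPhi fPhi μPhi μS μ0 μ1 νC νY φ := by
    intro φ
    rw [sum_comm]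
    refine Eq.trans (sum_congr rfl fun b _ => sum_Pev_and_eq μPhi μS μ0 μ1 νC νY
      (fun uP uS _ s1 nC _ => R1V fPhi fC f1 uS uP nC s1 = b ∧ PhiV fPhi uS uP = φ)
      fun uP uS s0 _ nC _ => R0V fPhi fC f0 uS uP nC s0) ?_
    exact sum_Pev_and_eq μPhi μS μ0 μ1 νC νY (fun uP uS _ _ _ _ => PhiV fPhi uS uP = φ)
      fun uP uS _ s1 nC _ => R1V fPhi fC f1 uS uP nC s1
  rw [hdo, sum_filter_of_ne]
  · simp_rw [Fintype.sum_prod_type, ← hcond, ← hX, mul_sum]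
    rw [sum_comm]
    refine sum_congr rfl fun a _ => ?_
    rw [sum_comm]
  · intro x _ hx
    exact (hnn _).lt_of_ne' (right_ne_zero_of_mul hx)

end Fig2
end

section
/- In a Fig-2 structural causal model, write κ(y | c, uΦ) := Σ_{nY} 1[fY(c, uΦ, nY) = y] νY(nY). Fix (r0, r1, φ, c) with P(R0 = r0, R1 = r1, Φ = φ, C = c) > 0. Then the observational conditional satisfies P(Y = y | R0 = r0, R1 = r1, Φ = φ, C = c) = Σ_{uΦ} κ(y | c, uΦ) · P(UΦ = uΦ | R0 = r0, R1 = r1, Φ = φ, C = c), whereas the interventional distribution satisfies P(Y = y | do(C = c)) = Σ_{uΦ} κ(y | c, uΦ) · μΦ(uΦ). Thus the observational predictor and the interventional predictor differ only in averaging the mechanism κ over the posterior of UΦ given the observed input versus its prior μΦ. -/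
open Finset

section Fig2

/- Exogenous types `UΦ, US, S0, S1, NC, NY` and endogenous value types
`Φ : PhiT`, `C : CT`, `R0 : R0T`, `R1 : R1T`, `Y : YT` of a Fig-2 structural causal
model, all finite and nonempty. -/
variable {UPhiT UST S0T S1T NCT NYT PhiT CT R0T R1T YT : Type*}
  [Fintype UPhiT] [Fintype UST] [Fintype S0T] [Fintype S1T] [Fintype NCT] [Fintype NYT]
  [Fintype PhiT] [Fintype CT] [Fintype R0T] [Fintype R1T] [Fintype YT]
  [Nonempty UPhiT] [Nonempty UST] [Nonempty S0T] [Nonempty S1T] [Nonempty NCT]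
  [Nonempty NYT] [Nonempty PhiT] [Nonempty CT] [Nonempty R0T] [Nonempty R1T] [Nonempty YT]

variable (fPhi : UST → UPhiT → PhiT) (fC : PhiT → NCT → CT)
  (f0 : S0T → CT → R0T) (f1 : S1T → CT → UST → R1T) (fY : CT → UPhiT → NYT → YT)

variable (μPhi : UPhiT → ℝ) (μS : UST → ℝ) (μ0 : S0T → ℝ) (μ1 : S1T → ℝ)
  (νC : NCT → ℝ) (νY : NYT → ℝ)

/-- The observational marginal `P(R0 = r0, R1 = r1, Φ = φ, C = c)`. -/
noncomputable def Pobs4 (r0 : R0T) (r1 : R1T) (φ : PhiT) (c : CT) : ℝ :=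
  Pev μPhi μS μ0 μ1 νC νY (fun uP uS s0 s1 nC _ =>
    R0V fPhi fC f0 uS uP nC s0 = r0 ∧ R1V fPhi fC f1 uS uP nC s1 = r1 ∧
      PhiV fPhi uS uP = φ ∧ CV fPhi fC uS uP nC = c)

/-- The observational joint `P(Y = y, R0 = r0, R1 = r1, Φ = φ, C = c)`. -/
noncomputable def PYobs4 (y : YT) (r0 : R0T) (r1 : R1T) (φ : PhiT) (c : CT) : ℝ :=
  Pev μPhi μS μ0 μ1 νC νY (fun uP uS s0 s1 nC nY =>
    R0V fPhi fC f0 uS uP nC s0 = r0 ∧ R1V fPhi fC f1 uS uP nC s1 = r1 ∧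
      PhiV fPhi uS uP = φ ∧ CV fPhi fC uS uP nC = c ∧ YV fPhi fC fY uS uP nC nY = y)

/-- The observational joint `P(UΦ = uΦ, R0 = r0, R1 = r1, Φ = φ, C = c)`. -/
noncomputable def PUobs4 (uP : UPhiT) (r0 : R0T) (r1 : R1T) (φ : PhiT) (c : CT) : ℝ :=
  Pev μPhi μS μ0 μ1 νC νY (fun uP' uS s0 s1 nC _ =>
    uP' = uP ∧ R0V fPhi fC f0 uS uP' nC s0 = r0 ∧ R1V fPhi fC f1 uS uP' nC s1 = r1 ∧
      PhiV fPhi uS uP' = φ ∧ CV fPhi fC uS uP' nC = c)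

open Classical in
/-- If the event `B` does not involve `NY` and `Q` involves only `(UΦ, NY)`, then the probability
of `B ∩ Q` is obtained by summing over the values of `UΦ`, by independence of `NY`. -/
theorem Pev_and_eq_sum {α β γ δ ε ζ : Type*} [Fintype α] [Fintype β] [Fintype γ] [Fintype δ]
    [Fintype ε] [Fintype ζ] (p : α → ℝ) (q : β → ℝ) (r : γ → ℝ) (s : δ → ℝ) (t : ε → ℝ)
    (w : ζ → ℝ) (hw : ∑ z, w z = 1) (B : α → β → γ → δ → ε → Prop) (Q : α → ζ → Prop) :
    Pev p q r s t w (fun a b c d e z => B a b c d e ∧ Q a z) =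
      ∑ a, (∑ z, if Q a z then w z else 0) *
        Pev p q r s t w (fun a' b c d e _ => a' = a ∧ B a' b c d e) := by
  have marginal (a : α) : Pev p q r s t w (fun a' b c d e _ => a' = a ∧ B a' b c d e) =
      ∑ b, ∑ c, ∑ d, ∑ e, if B a b c d e then p a * q b * r c * s d * t e else 0 := by
    unfold Pev
    rw [Finset.sum_eq_single a (fun a' _ h => by simp [h]) (by simp)]
    refine sum_congr rfl fun b _ => sum_congr rfl fun c _ => sum_congr rfl fun d _ =>
      sum_congr rfl fun e _ => ?_
    by_cases h : B a b c d e <;> simp [h, ← mul_sum, hw]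
  simp only [marginal]
  unfold Pev
  refine sum_congr rfl fun a _ => ?_
  simp only [mul_sum (s := (univ : Finset β)), mul_sum (s := (univ : Finset γ)),
    mul_sum (s := (univ : Finset δ)), mul_sum (s := (univ : Finset ε))]
  refine sum_congr rfl fun b _ => sum_congr rfl fun c _ => sum_congr rfl fun d _ =>
    sum_congr rfl fun e _ => ?_
  by_cases h : B a b c d e
  · simp only [h, true_and, if_true, sum_mul, ite_mul, zero_mul]
    exact sum_congr rfl fun z _ => by rw [mul_comm]
  · simp [h]

/-- In a Fig-2 structural causal model, with `κ(y | c, uΦ) := Σ_{nY} 1[fY(c,uΦ,nY) = y] νY(nY)`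
and `(r0, r1, φ, c)` of positive observational probability, the observational conditional
satisfies `P(Y = y | R0 = r0, R1 = r1, Φ = φ, C = c)
= Σ_{uΦ} κ(y | c, uΦ) · P(UΦ = uΦ | R0 = r0, R1 = r1, Φ = φ, C = c)`, whereas the
interventional distribution satisfies
`P(Y = y | do(C = c)) = Σ_{uΦ} κ(y | c, uΦ) · μΦ(uΦ)`: the two predictors differ only in
averaging the mechanism `κ` over the posterior of `UΦ` given the observed input versus
its prior `μΦ`. -/
theorem statement11
    (hμPhi : IsPMF μPhi) (hμS : IsPMF μS) (hμ0 : IsPMF μ0) (hμ1 : IsPMF μ1)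
    (hνC : IsPMF νC) (hνY : IsPMF νY)
    (r0 : R0T) (r1 : R1T) (φ : PhiT) (c : CT)
    (hpos : 0 < Pobs4 fPhi fC f0 f1 μPhi μS μ0 μ1 νC νY r0 r1 φ c) :
    (∀ y : YT,
      PYobs4 fPhi fC f0 f1 fY μPhi μS μ0 μ1 νC νY y r0 r1 φ c /
          Pobs4 fPhi fC f0 f1 μPhi μS μ0 μ1 νC νY r0 r1 φ c =
        ∑ uP, kappa fY νY y c uP *
          (PUobs4 fPhi fC f0 f1 μPhi μS μ0 μ1 νC νY uP r0 r1 φ c /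
            Pobs4 fPhi fC f0 f1 μPhi μS μ0 μ1 νC νY r0 r1 φ c)) ∧
    (∀ y : YT, doPC fY μPhi νY c y = ∑ uP, kappa fY νY y c uP * μPhi uP) := by
  refine ⟨fun y => ?_, fun y => ?_⟩
  · simp only [← mul_div_assoc, ← sum_div]
    congr 1
    refine Eq.trans ?_ (Pev_and_eq_sum μPhi μS μ0 μ1 νC νY hνY.2
      (fun uP uS s0 s1 nC => R0V fPhi fC f0 uS uP nC s0 = r0 ∧
        R1V fPhi fC f1 uS uP nC s1 = r1 ∧ PhiV fPhi uS uP = φ ∧ CV fPhi fC uS uP nC = c)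
      (fun uP nY => fY c uP nY = y))
    unfold PYobs4
    congr 1
    funext uP uS s0 s1 nC nY
    simp only [and_assoc]
    have hY (hC : CV fPhi fC uS uP nC = c) : YV fPhi fC fY uS uP nC nY = fY c uP nY :=
      congrArg (fY · uP nY) hC
    grind
  · simp only [doPC, kappa, mul_comm _ (μPhi _), mul_sum, mul_ite, mul_zero]

end Fig2
end
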